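/- Assume 1/2 ≤ d·θ² ≤ 1, and set S = E[(π1·Z1 + π2·Z2 − 1)²·(π1·Z1/(π1·Z1 + π2·Z2) − π1)]. There exist constants C_R = C_R(π) and C_T = C_T(π), depending only on π, such that for all n: |x_{n+1} − d·θ²·x_n − ((1 − 6π1π2)/(π1·π2²))·(d(d−1)/2)·θ⁴·x_n² − S| ≤ C_R·(d(d−1)/2)·|θ|⁵·|z_n − π1·x_n|·x_n + C_T·x_n³. -/

import Mathlib

open Finset Filter

namespace AsymIsing

/-- Level-`k` vertices of the rooted `d`-ary tree: paths of length `k` from the root. -/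
abbrev Vert (d k : ℕ) : Type := Fin k → Fin d

/-- A spin configuration on levels `0, …, n` of the `d`-ary tree. -/
abbrev Conf (d n : ℕ) : Type := ∀ k : Fin (n + 1), Vert d k → Fin 2

/-- A spin configuration on level `n` only. -/
abbrev LConf (d n : ℕ) : Type := Vert d n → Fin 2

/-- The transition matrix of the asymmetric binary channel; the paper's state `1`
corresponds to the index `0` and the state `2` to the index `1`. -/
noncomputable def Mmat (θ Δ : ℝ) : Fin 2 → Fin 2 → ℝ := fun i j =>
  if i = 0 then (if j = 0 then (1 + θ - Δ) / 2 else (1 - θ + Δ) / 2)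
  else (if j = 0 then (1 - θ - Δ) / 2 else (1 + θ + Δ) / 2)

/-- The stationary distribution `π = (π₁, π₂)` of the channel. -/
noncomputable def pst (θ Δ : ℝ) : Fin 2 → ℝ := fun i =>
  if i = 0 then 1 / 2 - Δ / (2 * (1 - θ)) else 1 / 2 + Δ / (2 * (1 - θ))

/-- The root spin of a configuration. -/
def root {d n : ℕ} (σ : Conf d n) : Fin 2 := σ ⟨0, n.succ_pos⟩ (fun i => i.elim0)

/-- The restriction of a configuration to the last (`n`-th) level. -/
def top {d n : ℕ} (σ : Conf d n) : LConf d n := σ (Fin.last n)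

/-- The probability of a full configuration on levels `0, …, n` under the broadcast
process: the root is drawn from `π` and spins propagate along edges via `M`. -/
noncomputable def confProb (d : ℕ) (θ Δ : ℝ) (n : ℕ) (σ : Conf d n) : ℝ :=
  pst θ Δ (root σ) *
    ∏ k : Fin n, ∏ v : Vert d (k + 1),
      Mmat θ Δ (σ k.castSucc (v ∘ Fin.castSucc)) (σ k.succ v)

/-- `P(σ(n) = A)`: the marginal law of the level-`n` spins. -/
noncomputable def levelProb (d : ℕ) (θ Δ : ℝ) (n : ℕ) (A : LConf d n) : ℝ :=
  ∑ σ : Conf d n, if top σ = A then confProb d θ Δ n σ else 0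

/-- `P(σ_ρ = i, σ(n) = A)`. -/
noncomputable def jointProb (d : ℕ) (θ Δ : ℝ) (n : ℕ) (i : Fin 2) (A : LConf d n) : ℝ :=
  ∑ σ : Conf d n, if root σ = i ∧ top σ = A then confProb d θ Δ n σ else 0

/-- The posterior `f_n(i, A) = P(σ_ρ = i ∣ σ(n) = A)`. -/
noncomputable def post (d : ℕ) (θ Δ : ℝ) (n : ℕ) (i : Fin 2) (A : LConf d n) : ℝ :=
  jointProb d θ Δ n i A / levelProb d θ Δ n A

/-- The law of `σ^i(n)`, i.e. `P(σ(n) = A ∣ σ_ρ = i)`. -/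
noncomputable def condLevel (d : ℕ) (θ Δ : ℝ) (n : ℕ) (i : Fin 2) (A : LConf d n) : ℝ :=
  jointProb d θ Δ n i A / pst θ Δ i

/-- The total variation distance between `σ^1(n)` and `σ^2(n)`. -/
noncomputable def tvDist (d : ℕ) (θ Δ : ℝ) (n : ℕ) : ℝ :=
  (1 / 2) * ∑ A : LConf d n, |condLevel d θ Δ n 0 A - condLevel d θ Δ n 1 A|

/-- The reconstruction problem is solvable if `limsup_n d_TV(σ^1(n), σ^2(n)) > 0`. -/
def solvable (d : ℕ) (θ Δ : ℝ) : Prop :=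
  0 < Filter.limsup (fun n => tvDist d θ Δ n) Filter.atTop

/-- Non-reconstruction: `limsup_n d_TV(σ^1(n), σ^2(n)) = 0`. -/
def nonReconstruction (d : ℕ) (θ Δ : ℝ) : Prop :=
  Filter.limsup (fun n => tvDist d θ Δ n) Filter.atTop = 0

/-- Expectation of a function of the level-`n` configuration, conditioned on `σ_ρ = 1`. -/
noncomputable def expect1 (d : ℕ) (θ Δ : ℝ) (n : ℕ) (g : LConf d n → ℝ) : ℝ :=
  ∑ A : LConf d n, condLevel d θ Δ n 0 A * g A

/-- `x_n = E f_n(1, σ^1(n)) − π₁`. -/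
noncomputable def xseq (d : ℕ) (θ Δ : ℝ) (n : ℕ) : ℝ :=
  expect1 d θ Δ n (fun A => post d θ Δ n 0 A) - pst θ Δ 0

/-- `z_n = E (f_n(1, σ^1(n)) − π₁)²`. -/
noncomputable def zseq (d : ℕ) (θ Δ : ℝ) (n : ℕ) : ℝ :=
  expect1 d θ Δ n (fun A => (post d θ Δ n 0 A - pst θ Δ 0) ^ 2)

/-- The restriction of a level-`(n+1)` configuration to the subtree of the `j`-th
child of the root (paths starting with `j`). -/
def restrictChild {d n : ℕ} (j : Fin d) (A : LConf d (n + 1)) : LConf d n :=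
  fun w => A (Fin.cons j w)

/-- `Y_j = f_n(1, σ_j(n+1))`, as a function of the level-`(n+1)` configuration. -/
noncomputable def Yfun (d : ℕ) (θ Δ : ℝ) (n : ℕ) (j : Fin d) (A : LConf d (n + 1)) : ℝ :=
  post d θ Δ n 0 (restrictChild j A)

/-- `Z₁ = ∏_j (1 + (θ/π₁)(Y_j − π₁))`, as a function of the level-`(n+1)` configuration. -/
noncomputable def Z1fun (d : ℕ) (θ Δ : ℝ) (n : ℕ) (A : LConf d (n + 1)) : ℝ :=
  ∏ j : Fin d, (1 + (θ / pst θ Δ 0) * (Yfun d θ Δ n j A - pst θ Δ 0))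

/-- `Z₂ = ∏_j (1 − (θ/π₂)(Y_j − π₁))`, as a function of the level-`(n+1)` configuration. -/
noncomputable def Z2fun (d : ℕ) (θ Δ : ℝ) (n : ℕ) (A : LConf d (n + 1)) : ℝ :=
  ∏ j : Fin d, (1 - (θ / pst θ Δ 1) * (Yfun d θ Δ n j A - pst θ Δ 0))

/-- The value of `Δ` making `π = (π₁, π₂)` the stationary distribution of the channel
with second eigenvalue `θ`, namely `Δ = (1 − θ)(π₂ − π₁)`. -/
noncomputable def Dlt (θ π1 π2 : ℝ) : ℝ := (1 - θ) * (π2 - π1)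

/-- The Gaussian-approximation function
`f(s) = E[π₁ e^{sμ₁+√s W₁} / (π₁ e^{sμ₁+√s W₁} + π₂ e^{sμ₂+√s W₂})] − π₁`,
where `μ₁ = 1/(2π₁)`, `μ₂ = −(1+π₂)/(2π₂²)`, `W₁ ∼ N(0, 1/π₁)` (realized as `w/√π₁`
for `w` standard Gaussian) and `W₂ = −(π₁/π₂)·W₁`. -/
noncomputable def gfun (π1 π2 : ℝ) (s : ℝ) : ℝ :=
  (∫ w : ℝ,
      (π1 * Real.exp (s * (1 / (2 * π1)) + Real.sqrt s * (w / Real.sqrt π1))) /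
        (π1 * Real.exp (s * (1 / (2 * π1)) + Real.sqrt s * (w / Real.sqrt π1)) +
          π2 * Real.exp (s * (-(1 + π2) / (2 * π2 ^ 2)) +
            Real.sqrt s * (-(π1 / π2) * (w / Real.sqrt π1))))
    ∂(ProbabilityTheory.gaussianReal 0 1)) - π1

/-- `S = E[(π₁Z₁ + π₂Z₂ − 1)²·(π₁Z₁/(π₁Z₁ + π₂Z₂) − π₁)]` under the conditioning
`σ_ρ = 1`. -/
noncomputable def Sterm (d : ℕ) (θ Δ : ℝ) (n : ℕ) : ℝ :=
  expect1 d θ Δ (n + 1) (fun A =>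
    (pst θ Δ 0 * Z1fun d θ Δ n A + pst θ Δ 1 * Z2fun d θ Δ n A - 1) ^ 2 *
      (pst θ Δ 0 * Z1fun d θ Δ n A /
          (pst θ Δ 0 * Z1fun d θ Δ n A + pst θ Δ 1 * Z2fun d θ Δ n A) -
        pst θ Δ 0))

/-- Product of the transition probabilities along all edges of a configuration. -/
noncomputable def edgeWeight (d : ℕ) (θ Δ : ℝ) (n : ℕ) (σ : Conf d n) : ℝ :=
  ∏ k : Fin n, ∏ v : Vert d (k + 1),
    Mmat θ Δ (σ k.castSucc (v ∘ Fin.castSucc)) (σ k.succ v)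

/-- A configuration on `n + 1` levels is a root spin together with a configuration on each
subtree of a child of the root. -/
def confEquiv (d n : ℕ) : Conf d (n + 1) ≃ Fin 2 × (Fin d → Conf d n) where
  toFun σ := (root σ, fun j k v => σ k.succ (Fin.cons j v))
  invFun p := fun k => Fin.cases (motive := fun k => Vert d k → Fin 2)
    (fun _ => p.1) (fun k v => p.2 (v (0 : Fin (k + 1))) k (fun i : Fin k => v i.succ)) k
  left_inv σ := by
    funext k
    refine Fin.cases ?_ (fun k => ?_) k
    · funext v
      exact congrArg (σ 0) (funext fun i => i.elim0)
    · funext v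
      exact congrArg (σ k.succ) (Fin.cons_self_tail v)
  right_inv p := by
    refine Prod.ext rfl ?_
    funext j k v
    rfl

lemma edgeWeight_succ (d : ℕ) (θ Δ : ℝ) (n : ℕ) (σ : Conf d (n + 1)) :
    edgeWeight d θ Δ (n + 1) σ = ∏ j : Fin d,
      Mmat θ Δ (root σ) (root ((confEquiv d n σ).2 j)) *
        edgeWeight d θ Δ n ((confEquiv d n σ).2 j) := by
  rw [edgeWeight, Fin.prod_univ_succ, Finset.prod_mul_distrib]
  congr 1
  · refine (Fintype.prod_equiv (Equiv.funUnique (Fin 1) (Fin d)) _ _ fun v => ?_)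
    congr 1
    · exact congrArg (σ 0) (funext fun i => i.elim0)
    · refine congrArg (σ 1) (funext fun i => ?_)
      rw [Subsingleton.elim i 0]
      rfl
  · simp only [edgeWeight]
    rw [Finset.prod_comm]
    refine Finset.prod_congr rfl fun k _ => ?_
    rw [← Finset.prod_product', Finset.univ_product_univ]
    refine (Fintype.prod_equiv (Fin.consEquiv fun _ : Fin (k + 1 + 1) => Fin d) _ _ fun p => ?_).symm
    congr 1
    refine congrArg (σ k.succ.castSucc) (funext fun i => ?_)
    refine Fin.cases ?_ (fun i => ?_) i <;> rfl

/-- Level-`(n+1)` configurations are families of level-`n` configurations. -/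
def levelEquiv (d n : ℕ) : LConf d (n + 1) ≃ (Fin d → LConf d n) where
  toFun A := fun j => restrictChild j A
  invFun B := fun v => B (v 0) (Fin.tail v)
  left_inv A := funext fun v => congrArg A (Fin.cons_self_tail v)
  right_inv _ := rfl

lemma condLevel_eq {d : ℕ} {θ Δ : ℝ} {n : ℕ} {i : Fin 2} (h : pst θ Δ i ≠ 0) (A : LConf d n) :
    condLevel d θ Δ n i A =
      ∑ σ : Conf d n, if root σ = i ∧ top σ = A then edgeWeight d θ Δ n σ else 0 := by
  rw [condLevel, jointProb, Finset.sum_div]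
  refine Finset.sum_congr rfl fun σ _ => ?_
  split_ifs with hσ
  · rw [confProb, hσ.1]
    exact mul_div_cancel_left₀ _ h
  · simp

lemma top_eq_iff {d n : ℕ} (σ : Conf d (n + 1)) (A : LConf d (n + 1)) :
    top σ = A ↔ ∀ j, top ((confEquiv d n σ).2 j) = restrictChild j A := by
  rw [← (levelEquiv d n).apply_eq_iff_eq, funext_iff]
  rfl

lemma condLevel_succ {d : ℕ} {θ Δ : ℝ} (h : ∀ i, pst θ Δ i ≠ 0) (n : ℕ) (i : Fin 2)
    (A : LConf d (n + 1)) :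
    condLevel d θ Δ (n + 1) i A =
      ∏ j : Fin d, ∑ k : Fin 2, Mmat θ Δ i k * condLevel d θ Δ n k (restrictChild j A) := by
  have hchild (B : LConf d n) : ∑ k : Fin 2, Mmat θ Δ i k * condLevel d θ Δ n k B =
      ∑ τ : Conf d n,
        if top τ = B then Mmat θ Δ i (root τ) * edgeWeight d θ Δ n τ else 0 := by
    simp_rw [condLevel_eq (h _), Finset.mul_sum]
    rw [Finset.sum_comm]
    refine Finset.sum_congr rfl fun τ _ => ?_
    by_cases hB : top τ = B <;> simp [hB]
  simp_rw [hchild]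
  rw [Finset.prod_univ_sum, Fintype.piFinset_univ, condLevel_eq (h i),
    ← (confEquiv d n).symm.sum_comp, Fintype.sum_prod_type, Finset.sum_eq_single i]
  · refine Finset.sum_congr rfl fun τ _ => ?_
    have hr : root ((confEquiv d n).symm (i, τ)) = i := rfl
    simp only [edgeWeight_succ, top_eq_iff, Equiv.apply_symm_apply, hr]
    by_cases hA : ∀ j, top (τ j) = restrictChild j A
    · simp [hA]
    · obtain ⟨j, hj⟩ := not_forall.mp hA
      rw [if_neg (fun h => hA h.2)]
      exact (Finset.prod_eq_zero (Finset.mem_univ j) (if_neg hj)).symm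
  · intro r _ hr
    refine Finset.sum_eq_zero fun τ _ => if_neg fun hτ => hr hτ.1
  · simp

lemma sum_prod_restrictChild {d n : ℕ} (g : LConf d n → ℝ) :
    ∑ A : LConf d (n + 1), ∏ j : Fin d, g (restrictChild j A) = (∑ B, g B) ^ d := by
  rw [Fintype.sum_pow]
  exact (levelEquiv d n).sum_comp fun p => ∏ j, g (p j)

lemma Mmat_row_sum (θ Δ : ℝ) (i : Fin 2) : ∑ k, Mmat θ Δ i k = 1 := by
  fin_cases i <;> simp [Mmat] <;> ring

lemma sum_condLevel {d : ℕ} {θ Δ : ℝ} (h : ∀ i, pst θ Δ i ≠ 0) (n : ℕ) (i : Fin 2) :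
    ∑ A : LConf d n, condLevel d θ Δ n i A = 1 := by
  induction n generalizing i with
  | zero =>
    simp_rw [condLevel_eq (h i)]
    rw [Finset.sum_comm]
    have hτ (τ : Conf d 0) : (∑ A : LConf d 0,
        if root τ = i ∧ top τ = A then edgeWeight d θ Δ 0 τ else 0) =
        if τ = (fun _ _ => i) then 1 else 0 := by
      have hi : root τ = i ↔ τ = fun _ _ => i := by
        constructor
        · intro hr
          funext k v
          obtain rfl : k = 0 := Fin.fin_one_eq_zero k
          rw [← hr]
          exact congrArg (τ 0) (funext fun i => i.elim0)
        · rintro rfl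
          rfl
      simp only [← hi]
      by_cases hr : root τ = i <;> simp [hr, edgeWeight]
    simp [hτ]
  | succ n ih =>
    simp_rw [condLevel_succ h]
    rw [sum_prod_restrictChild fun B => ∑ k : Fin 2, Mmat θ Δ i k * condLevel d θ Δ n k B,
      Finset.sum_comm]
    simp_rw [← Finset.mul_sum, ih, mul_one, Mmat_row_sum, one_pow]

lemma jointProb_eq {d : ℕ} {θ Δ : ℝ} {n : ℕ} {i : Fin 2} (h : pst θ Δ i ≠ 0) (A : LConf d n) :
    jointProb d θ Δ n i A = pst θ Δ i * condLevel d θ Δ n i A := by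
  rw [condLevel, mul_div_cancel₀ _ h]

lemma levelProb_eq_jointProb {d : ℕ} {θ Δ : ℝ} {n : ℕ} (A : LConf d n) :
    levelProb d θ Δ n A = jointProb d θ Δ n 0 A + jointProb d θ Δ n 1 A := by
  simp only [levelProb, jointProb]
  rw [← Finset.sum_add_distrib]
  refine Finset.sum_congr rfl fun σ _ => ?_
  have : root σ = 0 ∨ root σ = 1 := by omega
  by_cases hA : top σ = A <;> rcases this with hr | hr <;> simp [hA, hr]

lemma confProb_pos {d : ℕ} {θ Δ : ℝ} (h : ∀ i, 0 < pst θ Δ i) (hM : ∀ i j, 0 < Mmat θ Δ i j)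
    {n : ℕ} (σ : Conf d n) : 0 < confProb d θ Δ n σ :=
  mul_pos (h _) (Finset.prod_pos fun _ _ => Finset.prod_pos fun _ _ => hM _ _)

lemma levelProb_pos {d : ℕ} {θ Δ : ℝ} (h : ∀ i, 0 < pst θ Δ i) (hM : ∀ i j, 0 < Mmat θ Δ i j)
    {n : ℕ} (A : LConf d n) : 0 < levelProb d θ Δ n A := by
  refine Finset.sum_pos' (fun σ _ => ?_)
    ⟨Function.update (fun _ _ => 0) (Fin.last n) A, Finset.mem_univ _, ?_⟩
  · split_ifs
    exacts [(confProb_pos h hM σ).le, le_rfl]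
  · rw [if_pos (by simp [top])]
    exact confProb_pos h hM _

lemma jointProb_nonneg {d : ℕ} {θ Δ : ℝ} (h : ∀ i, 0 < pst θ Δ i)
    (hM : ∀ i j, 0 < Mmat θ Δ i j) {n : ℕ} (i : Fin 2) (A : LConf d n) :
    0 ≤ jointProb d θ Δ n i A := by
  refine Finset.sum_nonneg fun σ _ => ?_
  split_ifs
  exacts [(confProb_pos h hM σ).le, le_rfl]

lemma post_mem_Icc {d : ℕ} {θ Δ : ℝ} (h : ∀ i, 0 < pst θ Δ i)
    (hM : ∀ i j, 0 < Mmat θ Δ i j) {n : ℕ} (A : LConf d n) :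
    post d θ Δ n 0 A ∈ Set.Icc (0 : ℝ) 1 := by
  have h0 := jointProb_nonneg h hM 0 A
  have h1 := jointProb_nonneg h hM 1 A
  refine ⟨div_nonneg h0 (levelProb_pos h hM A).le, ?_⟩
  rw [post, div_le_one (levelProb_pos h hM A), levelProb_eq_jointProb]
  linarith

lemma levelProb_mul_post {d : ℕ} {θ Δ : ℝ} (h : ∀ i, 0 < pst θ Δ i)
    (hM : ∀ i j, 0 < Mmat θ Δ i j) {n : ℕ} (A : LConf d n) :
    levelProb d θ Δ n A * post d θ Δ n 0 A = pst θ Δ 0 * condLevel d θ Δ n 0 A ∧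
    levelProb d θ Δ n A * (1 - post d θ Δ n 0 A) = pst θ Δ 1 * condLevel d θ Δ n 1 A := by
  have hP := (levelProb_pos h hM A).ne'
  have h0 : levelProb d θ Δ n A * post d θ Δ n 0 A = jointProb d θ Δ n 0 A :=
    mul_div_cancel₀ _ hP
  rw [← jointProb_eq (h 0).ne', ← jointProb_eq (h 1).ne']
  refine ⟨h0, ?_⟩
  rw [mul_one_sub, h0, levelProb_eq_jointProb]
  ring

lemma pst_Dlt {θ π1 π2 : ℝ} (hθ : θ < 1) (hsum : π1 + π2 = 1) :
    pst θ (Dlt θ π1 π2) 0 = π1 ∧ pst θ (Dlt θ π1 π2) 1 = π2 := by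
  have : 1 - θ ≠ 0 := by linarith
  have h2 : π2 = 1 - π1 := by linarith
  subst h2
  constructor <;> simp [pst, Dlt] <;> field_simp <;> ring

section Recursion

variable {d : ℕ} {θ π1 π2 : ℝ}

lemma sum_Mmat_mul_condLevel (h1 : 0 < π1) (h2 : 0 < π2) (hsum : π1 + π2 = 1) (hθ : θ < 1)
    (hM : ∀ i j, 0 < Mmat θ (Dlt θ π1 π2) i j) {n : ℕ} (B : LConf d n) :
    ∑ k, Mmat θ (Dlt θ π1 π2) 0 k * condLevel d θ (Dlt θ π1 π2) n k B =
        levelProb d θ (Dlt θ π1 π2) n B *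
          (1 + θ / π1 * (post d θ (Dlt θ π1 π2) n 0 B - π1)) ∧
    ∑ k, Mmat θ (Dlt θ π1 π2) 1 k * condLevel d θ (Dlt θ π1 π2) n k B =
        levelProb d θ (Dlt θ π1 π2) n B *
          (1 - θ / π2 * (post d θ (Dlt θ π1 π2) n 0 B - π1)) := by
  obtain ⟨e1, e2⟩ := pst_Dlt hθ hsum
  have hpst : ∀ i, 0 < pst θ (Dlt θ π1 π2) i := by
    intro i; fin_cases i <;> simpa [e1, e2]
  obtain ⟨p1, p2⟩ := levelProb_mul_post hpst hM B
  rw [e1] at p1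
  rw [e2] at p2
  have c0 : condLevel d θ (Dlt θ π1 π2) n 0 B =
      levelProb d θ (Dlt θ π1 π2) n B * post d θ (Dlt θ π1 π2) n 0 B / π1 := by
    rw [p1, mul_div_cancel_left₀ _ h1.ne']
  have c1 : condLevel d θ (Dlt θ π1 π2) n 1 B =
      levelProb d θ (Dlt θ π1 π2) n B * (1 - post d θ (Dlt θ π1 π2) n 0 B) / π2 := by
    rw [p2, mul_div_cancel_left₀ _ h2.ne']
  rw [Fin.sum_univ_two, Fin.sum_univ_two, c0, c1]
  generalize levelProb d θ (Dlt θ π1 π2) n B = P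
  generalize post d θ (Dlt θ π1 π2) n 0 B = X
  obtain rfl : π1 = 1 - π2 := by linarith
  constructor <;> simp [Mmat, Dlt] <;> field_simp <;> ring

/-- Under the unconditioned law the subtrees of the children factor, with the root state `1`
giving the density `Z₁` and the root state `2` giving the density `Z₂`. -/
lemma condLevel_succ_eq (h1 : 0 < π1) (h2 : 0 < π2) (hsum : π1 + π2 = 1) (hθ : θ < 1)
    (hM : ∀ i j, 0 < Mmat θ (Dlt θ π1 π2) i j) {n : ℕ} (A : LConf d (n + 1)) :
    condLevel d θ (Dlt θ π1 π2) (n + 1) 0 A =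
        (∏ j, levelProb d θ (Dlt θ π1 π2) n (restrictChild j A)) *
          Z1fun d θ (Dlt θ π1 π2) n A ∧
    condLevel d θ (Dlt θ π1 π2) (n + 1) 1 A =
        (∏ j, levelProb d θ (Dlt θ π1 π2) n (restrictChild j A)) *
          Z2fun d θ (Dlt θ π1 π2) n A := by
  obtain ⟨e1, e2⟩ := pst_Dlt hθ hsum
  have hpst : ∀ i, pst θ (Dlt θ π1 π2) i ≠ 0 := by
    intro i; fin_cases i <;> simp [e1, e2, h1.ne', h2.ne']
  simp_rw [condLevel_succ hpst, (sum_Mmat_mul_condLevel h1 h2 hsum hθ hM _).1,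
    (sum_Mmat_mul_condLevel h1 h2 hsum hθ hM _).2, Finset.prod_mul_distrib, Z1fun, Z2fun, Yfun,
    e1, e2]
  simp

lemma post_succ_eq (h1 : 0 < π1) (h2 : 0 < π2) (hsum : π1 + π2 = 1) (hθ : θ < 1)
    (hM : ∀ i j, 0 < Mmat θ (Dlt θ π1 π2) i j) {n : ℕ} (A : LConf d (n + 1)) :
    post d θ (Dlt θ π1 π2) (n + 1) 0 A =
        π1 * Z1fun d θ (Dlt θ π1 π2) n A /
          (π1 * Z1fun d θ (Dlt θ π1 π2) n A + π2 * Z2fun d θ (Dlt θ π1 π2) n A) ∧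
    π1 * Z1fun d θ (Dlt θ π1 π2) n A + π2 * Z2fun d θ (Dlt θ π1 π2) n A ≠ 0 := by
  obtain ⟨e1, e2⟩ := pst_Dlt hθ hsum
  have hpst : ∀ i, 0 < pst θ (Dlt θ π1 π2) i := by
    intro i; fin_cases i <;> simpa [e1, e2]
  have hL := levelProb_pos hpst hM A
  have hP : 0 < ∏ j, levelProb d θ (Dlt θ π1 π2) n (restrictChild j A) :=
    Finset.prod_pos fun j _ => levelProb_pos hpst hM _
  obtain ⟨c0, c1⟩ := condLevel_succ_eq h1 h2 hsum hθ hM A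
  rw [levelProb_eq_jointProb, jointProb_eq (hpst 0).ne', jointProb_eq (hpst 1).ne', c0, c1,
    e1, e2] at hL
  refine ⟨?_, fun h0 => hL.ne' ?_⟩
  · rw [post, levelProb_eq_jointProb, jointProb_eq (hpst 0).ne', jointProb_eq (hpst 1).ne',
      c0, c1, e1, e2, mul_left_comm π1, mul_left_comm π2, ← mul_add,
      mul_div_mul_left _ _ hP.ne']
  · linear_combination (∏ j, levelProb d θ (Dlt θ π1 π2) n (restrictChild j A)) * h0

/-- Mixed moments of `Z₁` and `Z₂` given root state `1`. -/
lemma expect1_Z1fun_pow_mul_Z2fun_pow (h1 : 0 < π1) (h2 : 0 < π2) (hsum : π1 + π2 = 1)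
    (hθ : θ < 1) (hM : ∀ i j, 0 < Mmat θ (Dlt θ π1 π2) i j) (n a b : ℕ) :
    expect1 d θ (Dlt θ π1 π2) (n + 1) (fun A =>
        Z1fun d θ (Dlt θ π1 π2) n A ^ a * Z2fun d θ (Dlt θ π1 π2) n A ^ b) =
      (∑ B, levelProb d θ (Dlt θ π1 π2) n B *
        ((1 + θ / π1 * (post d θ (Dlt θ π1 π2) n 0 B - π1)) ^ (a + 1) *
          (1 - θ / π2 * (post d θ (Dlt θ π1 π2) n 0 B - π1)) ^ b)) ^ d := by
  obtain ⟨e1, e2⟩ := pst_Dlt hθ hsum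
  rw [← sum_prod_restrictChild fun B => levelProb d θ (Dlt θ π1 π2) n B *
        ((1 + θ / π1 * (post d θ (Dlt θ π1 π2) n 0 B - π1)) ^ (a + 1) *
          (1 - θ / π2 * (post d θ (Dlt θ π1 π2) n 0 B - π1)) ^ b), expect1]
  refine Finset.sum_congr rfl fun A _ => ?_
  rw [(condLevel_succ_eq h1 h2 hsum hθ hM A).1]
  simp only [Finset.prod_mul_distrib, Finset.prod_pow, Z1fun, Z2fun, Yfun, e1, e2]
  ring

/-- The recursion for `x_n`, with the denominator removed by
`1 / s = 1 - (s - 1) + (s - 1)² / s` where `s = π₁Z₁ + π₂Z₂`. -/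
lemma xseq_succ_sub_Sterm (h1 : 0 < π1) (h2 : 0 < π2) (hsum : π1 + π2 = 1) (hθ : θ < 1)
    (hM : ∀ i j, 0 < Mmat θ (Dlt θ π1 π2) i j) (n : ℕ) :
    xseq d θ (Dlt θ π1 π2) (n + 1) - Sterm d θ (Dlt θ π1 π2) n =
      expect1 d θ (Dlt θ π1 π2) (n + 1) (fun A =>
        π1 * π2 * (2 * (Z1fun d θ (Dlt θ π1 π2) n A ^ 1 * Z2fun d θ (Dlt θ π1 π2) n A ^ 0)
          - 2 * (Z1fun d θ (Dlt θ π1 π2) n A ^ 0 * Z2fun d θ (Dlt θ π1 π2) n A ^ 1)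
          - π1 * (Z1fun d θ (Dlt θ π1 π2) n A ^ 2 * Z2fun d θ (Dlt θ π1 π2) n A ^ 0)
          + (π1 - π2) * (Z1fun d θ (Dlt θ π1 π2) n A ^ 1 * Z2fun d θ (Dlt θ π1 π2) n A ^ 1)
          + π2 * (Z1fun d θ (Dlt θ π1 π2) n A ^ 0 * Z2fun d θ (Dlt θ π1 π2) n A ^ 2))) := by
  obtain ⟨e1, e2⟩ := pst_Dlt hθ hsum
  have hpst : ∀ i, pst θ (Dlt θ π1 π2) i ≠ 0 := by
    intro i; fin_cases i <;> simp [e1, e2, h1.ne', h2.ne']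
  have hc : pst θ (Dlt θ π1 π2) 0 =
      ∑ A, condLevel d θ (Dlt θ π1 π2) (n + 1) 0 A * pst θ (Dlt θ π1 π2) 0 := by
    rw [← Finset.sum_mul, sum_condLevel hpst, one_mul]
  rw [xseq, hc]
  simp only [expect1, Sterm, e1, e2]
  rw [← Finset.sum_sub_distrib, ← Finset.sum_sub_distrib]
  refine Finset.sum_congr rfl fun A _ => ?_
  obtain ⟨hp, hs⟩ := post_succ_eq h1 h2 hsum hθ hM A
  rw [hp, ← mul_sub, ← mul_sub]
  congr 1
  obtain rfl : π1 = 1 - π2 := by linarith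
  field_simp
  ring

end Recursion

/-- Second-order binomial expansion with a cubic remainder. -/
lemma abs_one_add_pow_sub_le (d : ℕ) (ε : ℝ) :
    |(1 + ε) ^ d - 1 - d * ε - (d : ℝ) * (d - 1) / 2 * ε ^ 2| ≤
      (d * |ε|) ^ 3 * (1 + |ε|) ^ d := by
  induction d with
  | zero => simp
  | succ d ih =>
    have he := abs_nonneg ε
    have hd : (0 : ℝ) ≤ d := d.cast_nonneg
    have hT : 0 ≤ (d : ℝ) * (d - 1) / 2 := by
      rcases Nat.eq_zero_or_pos d with rfl | hd'
      · simp
      · have : (1 : ℝ) ≤ d := by exact_mod_cast hd'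
        have : 0 ≤ (d : ℝ) - 1 := by linarith
        positivity
    have hstep : (1 + ε) ^ (d + 1) - 1 - ((d + 1 : ℕ) : ℝ) * ε -
        ((d + 1 : ℕ) : ℝ) * (((d + 1 : ℕ) : ℝ) - 1) / 2 * ε ^ 2 =
        (1 + ε) * ((1 + ε) ^ d - 1 - d * ε - (d : ℝ) * (d - 1) / 2 * ε ^ 2) +
          (d : ℝ) * (d - 1) / 2 * ε ^ 3 := by
      push_cast
      ring
    have hP : 1 ≤ (1 + |ε|) ^ (d + 1) := one_le_pow₀ (by linarith)
    have h1ε : |1 + ε| ≤ 1 + |ε| := (abs_add_le 1 ε).trans (by simp)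
    rw [hstep]
    calc |(1 + ε) * ((1 + ε) ^ d - 1 - d * ε - (d : ℝ) * (d - 1) / 2 * ε ^ 2) +
          (d : ℝ) * (d - 1) / 2 * ε ^ 3|
        ≤ (1 + |ε|) * ((d * |ε|) ^ 3 * (1 + |ε|) ^ d) + (d : ℝ) * (d - 1) / 2 * |ε| ^ 3 := by
          refine (abs_add_le _ _).trans (add_le_add ?_ ?_)
          · rw [abs_mul]
            exact mul_le_mul h1ε ih (abs_nonneg _) (by linarith)
          · rw [abs_mul, abs_of_nonneg hT, abs_pow]
      _ ≤ (1 + |ε|) * ((d * |ε|) ^ 3 * (1 + |ε|) ^ d) +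
            (d : ℝ) * (d - 1) / 2 * |ε| ^ 3 * (1 + |ε|) ^ (d + 1) := by
          exact add_le_add_right (le_mul_of_one_le_right (by positivity) hP) _
      _ = ((d : ℝ) ^ 3 + d * (d - 1) / 2) * (|ε| ^ 3 * (1 + |ε|) ^ (d + 1)) := by ring
      _ ≤ ((d : ℝ) + 1) ^ 3 * (|ε| ^ 3 * (1 + |ε|) ^ (d + 1)) := by
          gcongr
          nlinarith [sq_nonneg (d : ℝ)]
      _ = (((d + 1 : ℕ) : ℝ) * |ε|) ^ 3 * (1 + |ε|) ^ (d + 1) := by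
          push_cast
          ring

lemma exists_binomial_expansion_bound (α β : ℝ) :
    ∃ C : ℝ, ∀ (d : ℕ) (θ x w : ℝ), (d : ℝ) * θ ^ 2 ≤ 1 → |θ| ≤ 1 → 0 ≤ x → x ≤ 2 → |w| ≤ x →
      |(1 + (α * (θ ^ 2 * x) + β * (θ ^ 3 * w))) ^ d - 1 -
          d * (α * (θ ^ 2 * x) + β * (θ ^ 3 * w)) -
          (d : ℝ) * (d - 1) / 2 * (α * (θ ^ 2 * x) + β * (θ ^ 3 * w)) ^ 2| ≤ C * x ^ 3 := by
  refine ⟨(|α| + |β|) ^ 3 * Real.exp ((|α| + |β|) * 2), fun d θ x w hd hθ hx hx2 hw => ?_⟩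
  set ε := α * (θ ^ 2 * x) + β * (θ ^ 3 * w)
  have hεb : |ε| ≤ (|α| + |β|) * (θ ^ 2 * x) := by
    have hw3 : |θ ^ 3 * w| ≤ θ ^ 2 * x := by
      rw [abs_mul, pow_succ, abs_mul, abs_of_nonneg (sq_nonneg θ), mul_assoc]
      gcongr
      calc |θ| * |w| ≤ 1 * x := by gcongr
        _ = x := one_mul x
    calc |ε| ≤ |α| * (θ ^ 2 * x) + |β| * |θ ^ 3 * w| := by
          refine (abs_add_le _ _).trans_eq ?_
          rw [abs_mul, abs_mul β, abs_of_nonneg (by positivity : 0 ≤ θ ^ 2 * x)]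
      _ ≤ |α| * (θ ^ 2 * x) + |β| * (θ ^ 2 * x) := by gcongr
      _ = _ := by ring
  have hdε : d * |ε| ≤ (|α| + |β|) * x := by
    calc d * |ε| ≤ d * ((|α| + |β|) * (θ ^ 2 * x)) := by gcongr
      _ = (|α| + |β|) * x * (d * θ ^ 2) := by ring
      _ ≤ (|α| + |β|) * x * 1 := by gcongr
      _ = _ := mul_one _
  have hpow : (1 + |ε|) ^ d ≤ Real.exp ((|α| + |β|) * 2) := by
    calc (1 + |ε|) ^ d ≤ Real.exp |ε| ^ d := by
          gcongr
          linarith [Real.add_one_le_exp |ε|]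
      _ = Real.exp (d * |ε|) := (Real.exp_nat_mul _ _).symm
      _ ≤ _ := by
          exact Real.exp_le_exp.mpr (hdε.trans (by gcongr))
  calc _ ≤ (d * |ε|) ^ 3 * (1 + |ε|) ^ d := abs_one_add_pow_sub_le d ε
    _ ≤ ((|α| + |β|) * x) ^ 3 * Real.exp ((|α| + |β|) * 2) := by gcongr
    _ = _ := by ring

/-- Moments of the centred posterior under the unconditioned law, in terms of `x_n` and `z_n`. -/
lemma levelProb_moments {d : ℕ} {θ π1 π2 : ℝ} (h1 : 0 < π1) (h2 : 0 < π2) (hsum : π1 + π2 = 1)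
    (hθ : θ < 1) (hM : ∀ i j, 0 < Mmat θ (Dlt θ π1 π2) i j) (n : ℕ) :
    ∑ B, levelProb d θ (Dlt θ π1 π2) n B = 1 ∧
    ∑ B, levelProb d θ (Dlt θ π1 π2) n B * (post d θ (Dlt θ π1 π2) n 0 B - π1) = 0 ∧
    ∑ B, levelProb d θ (Dlt θ π1 π2) n B * (post d θ (Dlt θ π1 π2) n 0 B - π1) ^ 2 =
      π1 * xseq d θ (Dlt θ π1 π2) n ∧
    ∑ B, levelProb d θ (Dlt θ π1 π2) n B * (post d θ (Dlt θ π1 π2) n 0 B - π1) ^ 3 =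
      π1 * (zseq d θ (Dlt θ π1 π2) n - π1 * xseq d θ (Dlt θ π1 π2) n) := by
  obtain ⟨e1, e2⟩ := pst_Dlt hθ hsum
  have hpst : ∀ i, 0 < pst θ (Dlt θ π1 π2) i := by
    intro i; fin_cases i <;> simpa [e1, e2]
  have hc := sum_condLevel (d := d) (fun i => (hpst i).ne') n
  have hP (B : LConf d n) := (levelProb_mul_post hpst hM B).1
  simp only [e1] at hP
  have m0 : ∑ B, levelProb d θ (Dlt θ π1 π2) n B = 1 := by
    simp_rw [levelProb_eq_jointProb, jointProb_eq (hpst _).ne']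
    rw [Finset.sum_add_distrib, ← Finset.mul_sum, ← Finset.mul_sum, hc, hc, e1, e2]
    linarith
  have m1 : ∑ B, levelProb d θ (Dlt θ π1 π2) n B * (post d θ (Dlt θ π1 π2) n 0 B - π1) = 0 := by
    simp_rw [mul_sub, hP]
    rw [Finset.sum_sub_distrib, ← Finset.mul_sum, ← Finset.sum_mul, hc, m0]
    ring
  have m2 : ∑ B, levelProb d θ (Dlt θ π1 π2) n B *
      (post d θ (Dlt θ π1 π2) n 0 B - π1) ^ 2 = π1 * xseq d θ (Dlt θ π1 π2) n := by
    have hs (B : LConf d n) : levelProb d θ (Dlt θ π1 π2) n B *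
        (post d θ (Dlt θ π1 π2) n 0 B - π1) ^ 2 =
        π1 * (condLevel d θ (Dlt θ π1 π2) n 0 B * post d θ (Dlt θ π1 π2) n 0 B) -
          π1 ^ 2 * condLevel d θ (Dlt θ π1 π2) n 0 B -
          π1 * (levelProb d θ (Dlt θ π1 π2) n B * (post d θ (Dlt θ π1 π2) n 0 B - π1)) := by
      linear_combination (post d θ (Dlt θ π1 π2) n 0 B - π1) * hP B
    simp_rw [hs, Finset.sum_sub_distrib, ← Finset.mul_sum, hc, m1, xseq, expect1, e1]
    ring
  refine ⟨m0, m1, m2, ?_⟩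
  have hs (B : LConf d n) : levelProb d θ (Dlt θ π1 π2) n B *
      (post d θ (Dlt θ π1 π2) n 0 B - π1) ^ 3 =
      π1 * (condLevel d θ (Dlt θ π1 π2) n 0 B * (post d θ (Dlt θ π1 π2) n 0 B - π1) ^ 2) -
        π1 * (levelProb d θ (Dlt θ π1 π2) n B * (post d θ (Dlt θ π1 π2) n 0 B - π1) ^ 2) := by
    linear_combination (post d θ (Dlt θ π1 π2) n 0 B - π1) ^ 2 * hP B
  simp_rw [hs, Finset.sum_sub_distrib, ← Finset.mul_sum, m2, zseq, expect1, e1]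
  ring

lemma xseq_bounds {d : ℕ} {θ π1 π2 : ℝ} (h1 : 0 < π1) (h2 : 0 < π2) (hsum : π1 + π2 = 1)
    (hθ : θ < 1) (hM : ∀ i j, 0 < Mmat θ (Dlt θ π1 π2) i j) (n : ℕ) :
    0 ≤ xseq d θ (Dlt θ π1 π2) n ∧ π1 * xseq d θ (Dlt θ π1 π2) n ≤ 1 ∧
    |zseq d θ (Dlt θ π1 π2) n - π1 * xseq d θ (Dlt θ π1 π2) n| ≤
      xseq d θ (Dlt θ π1 π2) n := by
  obtain ⟨e1, e2⟩ := pst_Dlt hθ hsum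
  have hpst : ∀ i, 0 < pst θ (Dlt θ π1 π2) i := by
    intro i; fin_cases i <;> simpa [e1, e2]
  obtain ⟨m0, -, m2, m3⟩ := levelProb_moments (d := d) h1 h2 hsum hθ hM n
  have hP (B : LConf d n) := (levelProb_pos hpst hM B).le
  have hu (B : LConf d n) : |post d θ (Dlt θ π1 π2) n 0 B - π1| ≤ 1 := by
    obtain ⟨hl, hr⟩ := post_mem_Icc hpst hM B
    rw [abs_le]
    constructor <;> linarith
  refine ⟨?_, ?_, ?_⟩
  · refine nonneg_of_mul_nonneg_right ?_ h1
    rw [← m2]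
    exact Finset.sum_nonneg fun B _ => mul_nonneg (hP B) (sq_nonneg _)
  · rw [← m2, ← m0]
    exact Finset.sum_le_sum fun B _ => mul_le_of_le_one_right (hP B)
      ((sq_le_one_iff_abs_le_one _).mpr (hu B))
  · refine le_of_mul_le_mul_left ?_ h1
    calc π1 * |zseq d θ (Dlt θ π1 π2) n - π1 * xseq d θ (Dlt θ π1 π2) n|
        = |π1 * (zseq d θ (Dlt θ π1 π2) n - π1 * xseq d θ (Dlt θ π1 π2) n)| := by
          rw [abs_mul, abs_of_pos h1]
      _ ≤ π1 * xseq d θ (Dlt θ π1 π2) n := by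
          rw [← m3, ← m2]
          refine (Finset.abs_sum_le_sum_abs _ _).trans (Finset.sum_le_sum fun B _ => ?_)
          rw [abs_mul, abs_of_nonneg (hP B), pow_succ, abs_mul, abs_of_nonneg (sq_nonneg _)]
          exact mul_le_mul_of_nonneg_left (mul_le_of_le_one_right (sq_nonneg _) (hu B)) (hP B)

lemma sum_mul_cubic {ι : Type*} [Fintype ι] (P u : ι → ℝ) (c0 c1 c2 c3 : ℝ) :
    ∑ B, P B * (c0 + c1 * u B + c2 * u B ^ 2 + c3 * u B ^ 3) =
      c0 * ∑ B, P B + c1 * ∑ B, P B * u B + c2 * ∑ B, P B * u B ^ 2 +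
        c3 * ∑ B, P B * u B ^ 3 := by
  simp only [Finset.mul_sum, ← Finset.sum_add_distrib]
  exact Finset.sum_congr rfl fun B _ => by ring

/-- Closed form of the mixed moments of `Z₁` and `Z₂` of total degree at most two. -/
lemma expect1_eq_pow_of_cubic {d : ℕ} {θ π1 π2 : ℝ} (h1 : 0 < π1) (h2 : 0 < π2)
    (hsum : π1 + π2 = 1) (hθ : θ < 1) (hM : ∀ i j, 0 < Mmat θ (Dlt θ π1 π2) i j) (n a b : ℕ)
    {c1 c2 c3 : ℝ}
    (hc : ∀ t : ℝ, (1 + t / π1) ^ (a + 1) * (1 - t / π2) ^ b =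
      1 + c1 * t + c2 * t ^ 2 + c3 * t ^ 3) :
    expect1 d θ (Dlt θ π1 π2) (n + 1) (fun A =>
        Z1fun d θ (Dlt θ π1 π2) n A ^ a * Z2fun d θ (Dlt θ π1 π2) n A ^ b) =
      (1 + (c2 * π1 * (θ ^ 2 * xseq d θ (Dlt θ π1 π2) n) +
        c3 * π1 * (θ ^ 3 * (zseq d θ (Dlt θ π1 π2) n - π1 * xseq d θ (Dlt θ π1 π2) n)))) ^ d := by
  obtain ⟨m0, m1, m2, m3⟩ := levelProb_moments (d := d) h1 h2 hsum hθ hM n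
  rw [expect1_Z1fun_pow_mul_Z2fun_pow h1 h2 hsum hθ hM]
  congr 1
  have hB (B : LConf d n) :
      (1 + θ / π1 * (post d θ (Dlt θ π1 π2) n 0 B - π1)) ^ (a + 1) *
          (1 - θ / π2 * (post d θ (Dlt θ π1 π2) n 0 B - π1)) ^ b =
        1 + c1 * θ * (post d θ (Dlt θ π1 π2) n 0 B - π1) +
          c2 * θ ^ 2 * (post d θ (Dlt θ π1 π2) n 0 B - π1) ^ 2 +
          c3 * θ ^ 3 * (post d θ (Dlt θ π1 π2) n 0 B - π1) ^ 3 := by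
    rw [div_mul_eq_mul_div, div_mul_eq_mul_div, hc]
    ring
  simp_rw [hB]
  rw [sum_mul_cubic, m0, m1, m2, m3]
  ring

lemma expect1_linear_combination {d : ℕ} {θ Δ : ℝ} {n : ℕ} (π1 π2 : ℝ)
    (g1 g2 g3 g4 g5 : LConf d n → ℝ) :
    expect1 d θ Δ n (fun A => π1 * π2 * (2 * g1 A - 2 * g2 A - π1 * g3 A +
        (π1 - π2) * g4 A + π2 * g5 A)) =
      π1 * π2 * (2 * expect1 d θ Δ n g1 - 2 * expect1 d θ Δ n g2 - π1 * expect1 d θ Δ n g3 +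
        (π1 - π2) * expect1 d θ Δ n g4 + π2 * expect1 d θ Δ n g5) := by
  simp only [expect1, Finset.mul_sum, ← Finset.sum_add_distrib, ← Finset.sum_sub_distrib]
  exact Finset.sum_congr rfl fun A _ => by ring

/-- Main expansion of `x_{n+1}`: assuming `1/2 ≤ dθ² ≤ 1`, there are
constants `C_R = C_R(π)` and `C_T = C_T(π)` such that for all `n`,
`|x_{n+1} − dθ²x_n − ((1−6π₁π₂)/(π₁π₂²))·(d(d−1)/2)·θ⁴·x_n² − S|
  ≤ C_R·(d(d−1)/2)·|θ|⁵·|z_n − π₁x_n|·x_n + C_T·x_n³`. -/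
theorem xseq_main_expansion (π1 π2 : ℝ) (hsum : π1 + π2 = 1) (hord : π2 ≤ π1)
    (hpi2 : 0 < π2) :
    ∃ CR CT : ℝ, ∀ d : ℕ, 2 ≤ d → ∀ θ : ℝ, θ ≠ 0 →
      (∀ i j, 0 < Mmat θ (Dlt θ π1 π2) i j) →
      1 / 2 ≤ (d : ℝ) * θ ^ 2 → (d : ℝ) * θ ^ 2 ≤ 1 →
      ∀ n : ℕ,
        |xseq d θ (Dlt θ π1 π2) (n + 1) - (d : ℝ) * θ ^ 2 * xseq d θ (Dlt θ π1 π2) n -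
            (1 - 6 * π1 * π2) / (π1 * π2 ^ 2) * ((d : ℝ) * ((d : ℝ) - 1) / 2) * θ ^ 4 *
              xseq d θ (Dlt θ π1 π2) n ^ 2 -
            Sterm d θ (Dlt θ π1 π2) n| ≤
          CR * ((d : ℝ) * ((d : ℝ) - 1) / 2) * |θ| ^ 5 *
              |zseq d θ (Dlt θ π1 π2) n - π1 * xseq d θ (Dlt θ π1 π2) n| *
              xseq d θ (Dlt θ π1 π2) n +
            CT * xseq d θ (Dlt θ π1 π2) n ^ 3 := by
  have hpi1 : 0 < π1 := hpi2.trans_le hord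
  have hsum' : π2 = 1 - π1 := by linarith
  set α1 := 1 / π1 ^ 2 * π1 with hα1
  set α2 := -1 / (π1 * π2) * π1 with hα2
  set α3 := 3 / π1 ^ 2 * π1 with hα3
  set α4 := (1 / π1 ^ 2 - 2 / (π1 * π2)) * π1 with hα4
  set α5 := (1 / π2 ^ 2 - 2 / (π1 * π2)) * π1 with hα5
  set β3 := 1 / π1 ^ 3 * π1 with hβ3
  set β4 := -1 / (π1 ^ 2 * π2) * π1 with hβ4
  set β5 := 1 / (π1 * π2 ^ 2) * π1 with hβ5
  have hlin_x : π1 * π2 * (2 * α1 - 2 * α2 - π1 * α3 + (π1 - π2) * α4 + π2 * α5) = 1 := by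
    simp only [hα1, hα2, hα3, hα4, hα5]
    field_simp
    rw [hsum']
    ring
  have hlin_w : π1 * π2 * (-π1 * β3 + (π1 - π2) * β4 + π2 * β5) = 0 := by
    simp only [hβ3, hβ4, hβ5]
    field_simp
    ring
  have hquad : π1 * π2 *
      (2 * α1 ^ 2 - 2 * α2 ^ 2 - π1 * α3 ^ 2 + (π1 - π2) * α4 ^ 2 + π2 * α5 ^ 2) =
        (1 - 6 * π1 * π2) / (π1 * π2 ^ 2) := by
    simp only [hα1, hα2, hα3, hα4, hα5]
    field_simp
    rw [hsum']
    ring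
  obtain ⟨C1, hC1⟩ := exists_binomial_expansion_bound α1 (0 * π1)
  obtain ⟨C2, hC2⟩ := exists_binomial_expansion_bound α2 (0 * π1)
  obtain ⟨C3, hC3⟩ := exists_binomial_expansion_bound α3 β3
  obtain ⟨C4, hC4⟩ := exists_binomial_expansion_bound α4 β4
  obtain ⟨C5, hC5⟩ := exists_binomial_expansion_bound α5 β5
  set A := 2 * π1 * π2 * (-π1 * α3 * β3 + (π1 - π2) * α4 * β4 + π2 * α5 * β5) with hA
  set B := π1 * π2 * (-π1 * β3 ^ 2 + (π1 - π2) * β4 ^ 2 + π2 * β5 ^ 2) with hB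
  refine ⟨|A| + |B|, π1 * π2 * (2 * C1 + 2 * C2 + π1 * C3 + (π1 - π2) * C4 + π2 * C5), ?_⟩
  intro d hd θ _ hM _ hdθ n
  have hM00 := hM 0 0
  have hM01 := hM 0 1
  have hM10 := hM 1 0
  have hM11 := hM 1 1
  simp only [Mmat, ↓reduceIte, one_ne_zero] at hM00 hM01 hM10 hM11
  have hθ1 : θ < 1 := by linarith
  have hθ : |θ| ≤ 1 := abs_le.mpr ⟨by linarith, hθ1.le⟩
  obtain ⟨hx, hx1, hw⟩ := xseq_bounds (d := d) hpi1 hpi2 hsum hθ1 hM n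
  have hx2 : xseq d θ (Dlt θ π1 π2) n ≤ 2 := by nlinarith
  have hrec := xseq_succ_sub_Sterm (d := d) hpi1 hpi2 hsum hθ1 hM n
  rw [expect1_linear_combination,
    expect1_eq_pow_of_cubic hpi1 hpi2 hsum hθ1 hM n 1 0 (c1 := 2 / π1) (c2 := 1 / π1 ^ 2)
      (c3 := 0) (fun t => by ring),
    expect1_eq_pow_of_cubic hpi1 hpi2 hsum hθ1 hM n 0 1 (c1 := 1 / π1 - 1 / π2)
      (c2 := -1 / (π1 * π2)) (c3 := 0) (fun t => by ring),
    expect1_eq_pow_of_cubic hpi1 hpi2 hsum hθ1 hM n 2 0 (c1 := 3 / π1) (c2 := 3 / π1 ^ 2)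
      (c3 := 1 / π1 ^ 3) (fun t => by ring),
    expect1_eq_pow_of_cubic hpi1 hpi2 hsum hθ1 hM n 1 1 (c1 := 2 / π1 - 1 / π2)
      (c2 := 1 / π1 ^ 2 - 2 / (π1 * π2)) (c3 := -1 / (π1 ^ 2 * π2))
      (fun t => by ring),
    expect1_eq_pow_of_cubic hpi1 hpi2 hsum hθ1 hM n 0 2 (c1 := 1 / π1 - 2 / π2)
      (c2 := 1 / π2 ^ 2 - 2 / (π1 * π2)) (c3 := 1 / (π1 * π2 ^ 2))
      (fun t => by ring),
    ← hα1, ← hα2, ← hα3, ← hα4, ← hα5, ← hβ3, ← hβ4, ← hβ5] at hrec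
  set x := xseq d θ (Dlt θ π1 π2) n
  set w := zseq d θ (Dlt θ π1 π2) n - π1 * x
  replace hC1 := hC1 d θ x w hdθ hθ hx hx2 hw
  replace hC2 := hC2 d θ x w hdθ hθ hx hx2 hw
  replace hC3 := hC3 d θ x w hdθ hθ hx hx2 hw
  replace hC4 := hC4 d θ x w hdθ hθ hx hx2 hw
  replace hC5 := hC5 d θ x w hdθ hθ hx hx2 hw
  clear_value x w α1 α2 α3 α4 α5 β3 β4 β5
  set R1 := (1 + (α1 * (θ ^ 2 * x) + 0 * π1 * (θ ^ 3 * w))) ^ d - 1 -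
    d * (α1 * (θ ^ 2 * x) + 0 * π1 * (θ ^ 3 * w)) -
    (d : ℝ) * (d - 1) / 2 * (α1 * (θ ^ 2 * x) + 0 * π1 * (θ ^ 3 * w)) ^ 2 with hR1
  set R2 := (1 + (α2 * (θ ^ 2 * x) + 0 * π1 * (θ ^ 3 * w))) ^ d - 1 -
    d * (α2 * (θ ^ 2 * x) + 0 * π1 * (θ ^ 3 * w)) -
    (d : ℝ) * (d - 1) / 2 * (α2 * (θ ^ 2 * x) + 0 * π1 * (θ ^ 3 * w)) ^ 2 with hR2
  set R3 := (1 + (α3 * (θ ^ 2 * x) + β3 * (θ ^ 3 * w))) ^ d - 1 -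
    d * (α3 * (θ ^ 2 * x) + β3 * (θ ^ 3 * w)) -
    (d : ℝ) * (d - 1) / 2 * (α3 * (θ ^ 2 * x) + β3 * (θ ^ 3 * w)) ^ 2 with hR3
  set R4 := (1 + (α4 * (θ ^ 2 * x) + β4 * (θ ^ 3 * w))) ^ d - 1 -
    d * (α4 * (θ ^ 2 * x) + β4 * (θ ^ 3 * w)) -
    (d : ℝ) * (d - 1) / 2 * (α4 * (θ ^ 2 * x) + β4 * (θ ^ 3 * w)) ^ 2 with hR4
  set R5 := (1 + (α5 * (θ ^ 2 * x) + β5 * (θ ^ 3 * w))) ^ d - 1 -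
    d * (α5 * (θ ^ 2 * x) + β5 * (θ ^ 3 * w)) -
    (d : ℝ) * (d - 1) / 2 * (α5 * (θ ^ 2 * x) + β5 * (θ ^ 3 * w)) ^ 2 with hR5
  have hdecomp : xseq d θ (Dlt θ π1 π2) (n + 1) - (d : ℝ) * θ ^ 2 * x -
      (1 - 6 * π1 * π2) / (π1 * π2 ^ 2) * ((d : ℝ) * ((d : ℝ) - 1) / 2) * θ ^ 4 * x ^ 2 -
      Sterm d θ (Dlt θ π1 π2) n =
      (d : ℝ) * ((d : ℝ) - 1) / 2 * (A * (θ ^ 5 * w * x) + B * (θ ^ 6 * w ^ 2)) +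
      π1 * π2 * (2 * R1 - 2 * R2 - π1 * R3 + (π1 - π2) * R4 + π2 * R5) := by
    rw [← hquad, hA, hB, hR1, hR2, hR3, hR4, hR5]
    linear_combination hrec + d * (θ ^ 2 * x) * hlin_x + d * (θ ^ 3 * w) * hlin_w
  have hD : 0 ≤ (d : ℝ) * ((d : ℝ) - 1) / 2 := by
    have : (2 : ℝ) ≤ d := by exact_mod_cast hd
    have : 0 ≤ (d : ℝ) - 1 := by linarith
    positivity
  have hcross : |A * (θ ^ 5 * w * x) + B * (θ ^ 6 * w ^ 2)| ≤
      (|A| + |B|) * (|θ| ^ 5 * |w| * x) := by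
    have hw2 : |θ| ^ 6 * |w| ^ 2 ≤ |θ| ^ 5 * |w| * x := by
      calc |θ| ^ 6 * |w| ^ 2 = |θ| ^ 5 * |w| * (|θ| * |w|) := by ring
        _ ≤ |θ| ^ 5 * |w| * (1 * x) := by gcongr
        _ = |θ| ^ 5 * |w| * x := by rw [one_mul]
    calc |A * (θ ^ 5 * w * x) + B * (θ ^ 6 * w ^ 2)|
        ≤ |A| * (|θ| ^ 5 * |w| * x) + |B| * (|θ| ^ 6 * |w| ^ 2) := by
          refine (abs_add_le _ _).trans_eq ?_
          simp only [abs_mul, abs_pow, abs_of_nonneg hx]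
      _ ≤ |A| * (|θ| ^ 5 * |w| * x) + |B| * (|θ| ^ 5 * |w| * x) := by gcongr
      _ = _ := by ring
  have hrem : |2 * R1 - 2 * R2 - π1 * R3 + (π1 - π2) * R4 + π2 * R5| ≤
      (2 * C1 + 2 * C2 + π1 * C3 + (π1 - π2) * C4 + π2 * C5) * x ^ 3 := by
    have h3 := mul_le_mul_of_nonneg_left hC3 hpi1.le
    have h4 := mul_le_mul_of_nonneg_left hC4 (sub_nonneg.mpr hord)
    have h5 := mul_le_mul_of_nonneg_left hC5 hpi2.le
    rw [← abs_of_pos hpi1, ← abs_mul, abs_of_pos hpi1, abs_le] at h3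
    rw [← abs_of_nonneg (sub_nonneg.mpr hord), ← abs_mul, abs_of_nonneg (sub_nonneg.mpr hord),
      abs_le] at h4
    rw [← abs_of_pos hpi2, ← abs_mul, abs_of_pos hpi2, abs_le] at h5
    rw [abs_le] at hC1 hC2 ⊢
    constructor <;> linarith
  rw [hdecomp]
  refine (abs_add_le _ _).trans (add_le_add ?_ ?_)
  · rw [abs_mul, abs_of_nonneg hD]
    refine (mul_le_mul_of_nonneg_left hcross hD).trans_eq ?_
    ring
  · rw [abs_mul, abs_of_pos (mul_pos hpi1 hpi2)]
    refine (mul_le_mul_of_nonneg_left hrem (mul_pos hpi1 hpi2).le).trans_eq ?_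
    ring

end AsymIsing
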